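/- Lemma S1, dangerous stratum: Suppose Assumption 2 (monotonicity) holds. Then for any covariate V and any values v, a such that P(R = (1,1), V = v, A = a) > 0, P(D = 1 | R = (1,1), V = v, A = a) = P(D = 1, Y = 1 | V = v, A = a) / P(R = (1,1) | V = v, A = a). -/

import Mathlib

open MeasureTheory
open scoped Classical

/-- The probability of an event `E` under measure `P`, as a real number. -/
noncomputable def pr {Ω : Type*} [MeasurableSpace Ω] (P : Measure Ω) (E : Set Ω) : ℝ :=
  (P E).toReal

/-- The conditional probability `P(E | F) = P(E ∩ F) / P(F)`. -/
noncomputable def cpr {Ω : Type*} [MeasurableSpace Ω] (P : Measure Ω) (E F : Set Ω) : ℝ :=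
  pr P (E ∩ F) / pr P F

theorem lemma_s1_dangerous
    {Ω 𝒜 𝒱 : Type*} [Fintype Ω] [Fintype 𝒜] [Fintype 𝒱] [MeasurableSpace Ω]
    (P : Measure Ω) [IsProbabilityMeasure P]
    (D Y1 Y0 : Ω → Fin 2) (A : Ω → 𝒜) (V : Ω → 𝒱)
    (Y : Ω → Fin 2) (hY : ∀ ω, Y ω = if D ω = 1 then Y1 ω else Y0 ω)
    (R : Ω → Fin 2 × Fin 2) (hR : ∀ ω, R ω = (Y1 ω, Y0 ω))
    (mono : ∀ ω, Y1 ω ≤ Y0 ω)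
    :
    ∀ (v : 𝒱) (a : 𝒜),
      0 < pr P {ω | R ω = ((1 : Fin 2), (1 : Fin 2)) ∧ V ω = v ∧ A ω = a} →
      cpr P {ω | D ω = 1} {ω | R ω = ((1 : Fin 2), (1 : Fin 2)) ∧ V ω = v ∧ A ω = a}
        = cpr P {ω | D ω = 1 ∧ Y ω = 1} {ω | V ω = v ∧ A ω = a}
            / cpr P {ω | R ω = ((1 : Fin 2), (1 : Fin 2))} {ω | V ω = v ∧ A ω = a} := by
  intro v a hpos
  have hnum : {ω | D ω = 1} ∩ {ω | R ω = ((1 : Fin 2), (1 : Fin 2)) ∧ V ω = v ∧ A ω = a}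
      = {ω | D ω = 1 ∧ Y ω = 1} ∩ {ω | V ω = v ∧ A ω = a} := by
    ext ω
    have hm := mono ω
    simp only [Set.mem_inter_iff, Set.mem_ofPred_eq, hR, hY, Prod.mk.injEq]
    constructor
    · rintro ⟨hD, ⟨h1, -⟩, hVA⟩
      exact ⟨⟨hD, by simp [hD, h1]⟩, hVA⟩
    · rintro ⟨⟨hD, h1⟩, hVA⟩
      rw [if_pos hD] at h1
      exact ⟨hD, ⟨h1, by omega⟩, hVA⟩
  have hden : {ω | R ω = ((1 : Fin 2), (1 : Fin 2))} ∩ {ω | V ω = v ∧ A ω = a}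
      = {ω | R ω = ((1 : Fin 2), (1 : Fin 2)) ∧ V ω = v ∧ A ω = a} := rfl
  have hVA : pr P {ω | V ω = v ∧ A ω = a} ≠ 0 :=
    (hpos.trans_le (measureReal_mono (μ := P) fun _ h => h.2)).ne'
  rw [cpr, cpr, cpr, hnum, hden, div_div_div_cancel_right₀ hVA]
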